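/- arXiv:1508.05183 — 4 statements merged into one kernel-verified Lean document; each statement's English description precedes it below -/
import Mathlib

section
/- Let X and A be complex numbers such that cos A ≠ 0 (equivalently, A is not an odd multiple of π/2). Then the partial products ∏_{k=1}^{N} (1 − X/((k − 1/2)π − A)) · (1 + X/((k − 1/2)π + A)) converge, as N → ∞, to cos(X + A)/cos A. -/
open Filter Real Topology

/-- If `cos A ≠ 0` then `A` differs from every half-integer multiple `(k + 1/2)π`. -/
lemma half_add_nat_mul_pi_sub_ne_zero {A : ℂ} (hA : Complex.cos A ≠ 0) (k : ℕ) :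
    (((k : ℂ) + 1) - 1/2) * (π : ℂ) - A ≠ 0 := by
  intro h
  refine hA (Complex.cos_eq_zero_iff.2 ⟨k, ?_⟩)
  push_cast
  linear_combination -h

lemma half_add_nat_mul_pi_add_ne_zero {A : ℂ} (hA : Complex.cos A ≠ 0) (k : ℕ) :
    (((k : ℂ) + 1) - 1/2) * (π : ℂ) + A ≠ 0 := by
  have h := half_add_nat_mul_pi_sub_ne_zero (A := -A) (by rwa [Complex.cos_neg]) k
  rwa [sub_neg_eq_add] at h

/-- A zero of the cosine is, up to sign, of the form `(k + 1/2)π` with `k` a natural number. -/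
lemma exists_nat_of_cos_eq_zero {z : ℂ} (hz : Complex.cos z = 0) :
    ∃ k : ℕ, (((k : ℂ) + 1) - 1/2) * (π : ℂ) - z = 0 ∨
      (((k : ℂ) + 1) - 1/2) * (π : ℂ) + z = 0 := by
  obtain ⟨m, rfl⟩ := Complex.cos_eq_zero_iff.1 hz
  rcases le_or_gt 0 m with hm | hm
  · lift m to ℕ using hm
    refine ⟨m, Or.inl ?_⟩
    push_cast
    ring
  · obtain ⟨n, hn⟩ := Int.eq_ofNat_of_zero_le (show 0 ≤ -m - 1 by lia)
    refine ⟨n, Or.inr ?_⟩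
    have hm' : m = -(n : ℤ) - 1 := by lia
    rw [hm']
    push_cast
    ring

lemma ramanujan_factor_eq {X A : ℂ} (hA : Complex.cos A ≠ 0) (k : ℕ) :
    (1 - X / ((((k : ℂ) + 1) - 1/2) * (π : ℂ) - A)) *
        (1 + X / ((((k : ℂ) + 1) - 1/2) * (π : ℂ) + A)) =
      (((((k : ℂ) + 1) - 1/2) * (π : ℂ) - (X + A)) *
          ((((k : ℂ) + 1) - 1/2) * (π : ℂ) + (X + A))) /
        (((((k : ℂ) + 1) - 1/2) * (π : ℂ) - A) * ((((k : ℂ) + 1) - 1/2) * (π : ℂ) + A)) := by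
  have h₁ := half_add_nat_mul_pi_sub_ne_zero hA k
  have h₂ := half_add_nat_mul_pi_add_ne_zero hA k
  rw [one_sub_div h₁, one_add_div h₂, div_mul_div_comm]
  ring

/-- Euler's limit for the Gamma function together with the reflection formula. -/
lemma tendsto_GammaSeq_mul_GammaSeq_cos (z : ℂ) :
    Tendsto (fun n : ℕ => Complex.GammaSeq (1/2 - z / π) n * Complex.GammaSeq (1/2 + z / π) n)
      atTop (𝓝 (π / Complex.cos z)) := by
  have hπ : (π : ℂ) ≠ 0 := Complex.ofReal_ne_zero.2 pi_ne_zero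
  have h := (Complex.GammaSeq_tendsto_Gamma (1/2 - z / π)).mul
    (Complex.GammaSeq_tendsto_Gamma (1/2 + z / π))
  have h₁ : (1/2 + z / π : ℂ) = 1 - (1/2 - z / π) := by ring
  have h₂ : (π : ℂ) * (1/2 - z / π) = π / 2 - z := by field_simp
  have h₃ : Complex.Gamma (1/2 - z / π) * Complex.Gamma (1/2 + z / π) = π / Complex.cos z := by
    rw [h₁, Complex.Gamma_mul_Gamma_one_sub, h₂, Complex.sin_pi_div_two_sub]
  rwa [h₃] at h

lemma GammaSeq_mul_GammaSeq_eq (z : ℂ) {n : ℕ} (hn : n ≠ 0) :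
    Complex.GammaSeq (1/2 - z / π) n * Complex.GammaSeq (1/2 + z / π) n =
      (n * (n.factorial : ℂ) ^ 2 * ((π : ℂ) ^ 2) ^ (n + 1)) /
        ∏ k ∈ Finset.range (n + 1),
          (((((k : ℂ) + 1) - 1/2) * (π : ℂ) - z) * ((((k : ℂ) + 1) - 1/2) * (π : ℂ) + z)) := by
  have hπ : (π : ℂ) ≠ 0 := Complex.ofReal_ne_zero.2 pi_ne_zero
  have hn' : (n : ℂ) ≠ 0 := Nat.cast_ne_zero.2 hn
  have hpow : (n : ℂ) ^ (1/2 - z / π : ℂ) * (n : ℂ) ^ (1/2 + z / π : ℂ) = n := by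
    rw [← Complex.cpow_add _ _ hn']
    ring_nf
    exact Complex.cpow_one _
  have hprod : ∏ k ∈ Finset.range (n + 1),
      (((((k : ℂ) + 1) - 1/2) * (π : ℂ) - z) * ((((k : ℂ) + 1) - 1/2) * (π : ℂ) + z)) =
      ((π : ℂ) ^ 2) ^ (n + 1) * ((∏ k ∈ Finset.range (n + 1), (1/2 - z / π + (k : ℂ))) *
        ∏ k ∈ Finset.range (n + 1), (1/2 + z / π + (k : ℂ))) := by
    rw [← Finset.prod_mul_distrib, ← Finset.card_range (n + 1), ← Finset.prod_const,
      Finset.card_range, ← Finset.prod_mul_distrib]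
    refine Finset.prod_congr rfl fun k _ => ?_
    field_simp
    ring
  rw [hprod, mul_comm (((π : ℂ) ^ 2) ^ (n + 1)),
    mul_div_mul_right _ _ (pow_ne_zero _ (pow_ne_zero 2 hπ)), Complex.GammaSeq,
    Complex.GammaSeq, div_mul_div_comm]
  congr 1
  linear_combination (n.factorial : ℂ) ^ 2 * hpow

/-- Ramanujan's product identity for the cosine: for complex `X`, `A` with
`cos A ≠ 0`, the partial products of the paired factors
`(1 - X/((k - 1/2)π - A)) * (1 + X/((k - 1/2)π + A))` for `k = 1, …, N`
converge, as `N → ∞`, to `cos (X + A) / cos A`. -/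
theorem ramanujan_cos_product (X A : ℂ) (hA : Complex.cos A ≠ 0) :
    Tendsto
      (fun N : ℕ => ∏ k ∈ Finset.range N,
        ((1 - X / ((((k : ℂ) + 1) - 1/2) * (π : ℂ) - A)) *
          (1 + X / ((((k : ℂ) + 1) - 1/2) * (π : ℂ) + A))))
      atTop (𝓝 (Complex.cos (X + A) / Complex.cos A)) := by
  have hπ : (π : ℂ) ≠ 0 := Complex.ofReal_ne_zero.2 pi_ne_zero
  simp_rw [ramanujan_factor_eq hA]
  by_cases hX : Complex.cos (X + A) = 0
  · obtain ⟨k, hk⟩ := exists_nat_of_cos_eq_zero hX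
    rw [hX, zero_div]
    refine tendsto_const_nhds.congr' ?_
    filter_upwards [eventually_gt_atTop k] with N hN
    refine (Finset.prod_eq_zero (Finset.mem_range.2 hN) ?_).symm
    rw [mul_eq_zero.2 hk, zero_div]
  · rw [← tendsto_add_atTop_iff_nat 1]
    have h := (tendsto_GammaSeq_mul_GammaSeq_cos A).div
      (tendsto_GammaSeq_mul_GammaSeq_cos (X + A)) (div_ne_zero hπ hX)
    rw [div_div_div_cancel_left' _ _ hπ] at h
    refine h.congr' ?_
    filter_upwards [eventually_ne_atTop 0] with n hn
    have hc : (n * (n.factorial : ℂ) ^ 2 * ((π : ℂ) ^ 2) ^ (n + 1)) ≠ 0 :=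
      mul_ne_zero (mul_ne_zero (Nat.cast_ne_zero.2 hn)
        (pow_ne_zero 2 (Nat.cast_ne_zero.2 n.factorial_ne_zero)))
        (pow_ne_zero _ (pow_ne_zero 2 hπ))
    rw [Pi.div_apply, GammaSeq_mul_GammaSeq_eq A hn, GammaSeq_mul_GammaSeq_eq (X + A) hn,
      div_div_div_cancel_left' _ _ hc, Finset.prod_div_distrib]
end

section
/- Let A and B be real numbers with B/π not an integer. Then arctan(tanh A · cot B) = arctan(A/B) + ∑_{k=1}^{∞} ( arctan(A/(B + kπ)) + arctan(A/(B − kπ)) ), where the series on the right converges. -/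
open Filter Real Topology

/-- The partial fraction expansion of the cotangent, with poles at the multiples of `π`. -/
lemma hasSum_cot_sub_inv {w : ℂ} (hw : ∀ n : ℤ, w ≠ n * π) :
    HasSum (fun k : ℕ => (w + ((k : ℂ) + 1) * π)⁻¹ + (w - ((k : ℂ) + 1) * π)⁻¹)
      (Complex.cot w - w⁻¹) := by
  have hpi : (π : ℂ) ≠ 0 := Complex.ofReal_ne_zero.mpr pi_ne_zero
  have hz : w / π ∈ Complex.integerComplement := by
    rintro ⟨n, hn⟩
    exact hw n (by rw [hn]; field_simp)
  have h := (summable_cotTerm hz).hasSum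
  rw [← cot_series_rep' hz] at h
  have hcot : (π : ℂ)⁻¹ * (π * Complex.cot (π * (w / π)) - 1 / (w / π)) =
      Complex.cot w - w⁻¹ := by
    rw [show (π : ℂ) * (w / π) = w by field_simp, one_div_div, mul_sub, inv_mul_cancel_left₀ hpi,
      div_eq_mul_inv, inv_mul_cancel_left₀ hpi]
  rw [← hcot]
  refine (h.mul_left (π : ℂ)⁻¹).congr_fun fun k => ?_
  have h₁ : w / π + ((k : ℂ) + 1) = (w + ((k : ℂ) + 1) * π) / π := by field_simp
  have h₂ : w / π - ((k : ℂ) + 1) = (w - ((k : ℂ) + 1) * π) / π := by field_simp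
  rw [cotTerm, h₁, h₂, one_div_div, one_div_div, add_comm, mul_add]
  simp only [div_eq_mul_inv, inv_mul_cancel_left₀ hpi]

lemma re_inv_add_mul_I (c y : ℝ) : ((c + y * Complex.I : ℂ)⁻¹).re = c / (c ^ 2 + y ^ 2) := by
  simp [Complex.inv_re, Complex.normSq_apply, sq]

lemma cosh_sq_mul_sin_sq_add_pos {B : ℝ} (hB : sin B ≠ 0) (y : ℝ) :
    0 < cosh y ^ 2 * sin B ^ 2 + sinh y ^ 2 * cos B ^ 2 := by
  have := cosh_pos y
  positivity

lemma re_cot_add_mul_I (B y : ℝ) :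
    (Complex.cot (B + y * Complex.I)).re =
      sin B * cos B / (cosh y ^ 2 * sin B ^ 2 + sinh y ^ 2 * cos B ^ 2) := by
  rw [Complex.cot_eq_cos_div_sin, Complex.cos_add_mul_I, Complex.sin_add_mul_I]
  simp only [← Complex.ofReal_sin, ← Complex.ofReal_cos, ← Complex.ofReal_sinh,
    ← Complex.ofReal_cosh, ← Complex.ofReal_mul]
  have hN : Complex.normSq (((sin B * cosh y : ℝ) : ℂ) + ((cos B * sinh y : ℝ) : ℂ) * Complex.I) =
      cosh y ^ 2 * sin B ^ 2 + sinh y ^ 2 * cos B ^ 2 := by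
    rw [Complex.normSq_add_mul_I]
    ring
  rw [Complex.div_re, hN, ← add_div]
  congr 1
  simp only [Complex.sub_re, Complex.sub_im, Complex.add_re, Complex.add_im, Complex.re_ofReal_mul,
    Complex.im_ofReal_mul, Complex.ofReal_re, Complex.ofReal_im, Complex.I_re, Complex.I_im]
  linear_combination sin B * cos B * cosh_sq y

lemma hasDerivAt_arctan_div {c : ℝ} (hc : c ≠ 0) (y : ℝ) :
    HasDerivAt (fun t => arctan (t / c)) (c / (c ^ 2 + y ^ 2)) y := by
  refine ((hasDerivAt_id y).div_const c).arctan.congr_deriv ?_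
  have : c ^ 2 + y ^ 2 ≠ 0 := by positivity
  simp only [id]
  field_simp

lemma hasDerivAt_tanh (y : ℝ) : HasDerivAt tanh (1 / cosh y ^ 2) y := by
  have h := (hasDerivAt_sinh y).div (hasDerivAt_cosh y) (cosh_pos y).ne'
  rw [show tanh = sinh / cosh from funext tanh_eq_sinh_div_cosh]
  refine h.congr_deriv ?_
  congr 1
  linear_combination cosh_sq y

lemma hasDerivAt_arctan_tanh_mul_cot {B : ℝ} (hB : sin B ≠ 0) (y : ℝ) :
    HasDerivAt (fun t => arctan (tanh t * cot B))
      (sin B * cos B / (cosh y ^ 2 * sin B ^ 2 + sinh y ^ 2 * cos B ^ 2)) y := by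
  refine ((hasDerivAt_tanh y).mul_const (cot B)).arctan.congr_deriv ?_
  have hD := (cosh_sq_mul_sin_sq_add_pos hB y).ne'
  have hc := (cosh_pos y).ne'
  rw [tanh_eq_sinh_div_cosh, cot_eq_cos_div_sin]
  have : 1 + (sinh y / cosh y * (cos B / sin B)) ^ 2 =
      (cosh y ^ 2 * sin B ^ 2 + sinh y ^ 2 * cos B ^ 2) / (cosh y ^ 2 * sin B ^ 2) := by
    field_simp
  rw [this]
  field_simp

lemma abs_div_sq_add_sq_add_le {c d : ℝ} (hc : c ≠ 0) (hd : d ≠ 0) (y : ℝ) :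
    |c / (c ^ 2 + y ^ 2) + d / (d ^ 2 + y ^ 2)| ≤ |c⁻¹ + d⁻¹| := by
  have hc' : 0 < c ^ 2 + y ^ 2 := by positivity
  have hd' : 0 < d ^ 2 + y ^ 2 := by positivity
  have hcd : 0 < |c * d| := by positivity
  have h₁ : c / (c ^ 2 + y ^ 2) + d / (d ^ 2 + y ^ 2) =
      (c + d) * ((c * d + y ^ 2) / ((c ^ 2 + y ^ 2) * (d ^ 2 + y ^ 2))) := by
    field_simp
    ring
  have h₂ : c⁻¹ + d⁻¹ = (c + d) * (1 / (c * d)) := by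
    field_simp
    ring
  rw [h₁, h₂, abs_mul, abs_mul]
  refine mul_le_mul_of_nonneg_left ?_ (abs_nonneg _)
  rw [abs_div, abs_div, abs_one, abs_of_pos (mul_pos hc' hd'), div_le_div_iff₀ (by positivity) hcd,
    one_mul]
  have h₃ : |c * d + y ^ 2| ≤ |c * d| + y ^ 2 := by
    exact (abs_add_le _ _).trans_eq (by rw [abs_of_nonneg (sq_nonneg y)])
  have h₄ : 2 * |c * d| ≤ c ^ 2 + d ^ 2 := by
    rw [abs_mul]
    nlinarith [sq_nonneg (|c| - |d|), sq_abs c, sq_abs d]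
  nlinarith [sq_abs (c * d), mul_le_mul_of_nonneg_left h₄ (sq_nonneg y),
    mul_le_mul_of_nonneg_right h₃ hcd.le, mul_nonneg (sq_nonneg y) hcd.le, sq_nonneg (y ^ 2)]

/-- The real part of the partial fraction expansion of the cotangent on a vertical line. -/
lemma hasSum_re_cot {B : ℝ} (hB : ∀ n : ℤ, B ≠ n * π) (y : ℝ) :
    HasSum (fun k : ℕ =>
      (B + ((k : ℝ) + 1) * π) / ((B + ((k : ℝ) + 1) * π) ^ 2 + y ^ 2) +
        (B - ((k : ℝ) + 1) * π) / ((B - ((k : ℝ) + 1) * π) ^ 2 + y ^ 2))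
      ((Complex.cot (B + y * Complex.I)).re - B / (B ^ 2 + y ^ 2)) := by
  have hw (n : ℤ) : (B + y * Complex.I : ℂ) ≠ n * π := fun h =>
    hB n (by simpa using congrArg Complex.re h)
  have h := Complex.hasSum_re (hasSum_cot_sub_inv hw)
  rw [Complex.sub_re, re_inv_add_mul_I] at h
  refine h.congr_fun fun k => ?_
  rw [Complex.add_re, ← re_inv_add_mul_I, ← re_inv_add_mul_I]
  push_cast
  ring_nf

/-- Ramanujan's arctangent identity: for real `A`, `B` with `B/π` not an
integer, `arctan (tanh A * cot B) = arctan (A/B) + ∑_{k≥1} (arctan (A/(B + kπ))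
+ arctan (A/(B - kπ)))`, the series (summed in symmetric pairs) converging. -/
theorem ramanujan_arctan (A B : ℝ) (hB : ∀ n : ℤ, B ≠ n * π) :
    Tendsto
      (fun N : ℕ => Real.arctan (A / B) + ∑ k ∈ Finset.range N,
        (Real.arctan (A / (B + ((k : ℝ) + 1) * π)) +
          Real.arctan (A / (B - ((k : ℝ) + 1) * π))))
      atTop (𝓝 (Real.arctan (Real.tanh A * Real.cot B))) := by
  have hB₀ : B ≠ 0 := by simpa using hB 0
  have hsin : sin B ≠ 0 := sin_ne_zero_iff.mpr fun n => (hB n).symm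
  have hadd (k : ℕ) : B + ((k : ℝ) + 1) * π ≠ 0 := fun h =>
    hB (-((k : ℤ) + 1)) (by push_cast; linarith)
  have hsub (k : ℕ) : B - ((k : ℝ) + 1) * π ≠ 0 := fun h =>
    hB ((k : ℤ) + 1) (by push_cast; linarith)
  set g : ℕ → ℝ → ℝ := fun k y => arctan (y / (B + ((k : ℝ) + 1) * π)) +
    arctan (y / (B - ((k : ℝ) + 1) * π)) with hg
  have hderiv (k : ℕ) (y : ℝ) := (hasDerivAt_arctan_div (hadd k) y).add
    (hasDerivAt_arctan_div (hsub k) y)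
  have hbound (k : ℕ) (y : ℝ) := abs_div_sq_add_sq_add_le (hadd k) (hsub k) y
  have hu : Summable fun k : ℕ =>
      |(B + ((k : ℝ) + 1) * π)⁻¹ + (B - ((k : ℝ) + 1) * π)⁻¹| := by
    refine ((hasSum_re_cot hB 0).summable.abs).congr fun k => ?_
    simp [sq]
  have hg₀ : Summable fun k => g k 0 := by simp [hg, summable_zero]
  have hsum : Summable fun k => g k A := summable_of_summable_hasDerivAt hu hderiv hbound hg₀ A
  have hzero (y : ℝ) : HasDerivAt
      (fun t => arctan (tanh t * cot B) - (arctan (t / B) + ∑' k, g k t)) 0 y := by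
    refine ((hasDerivAt_arctan_tanh_mul_cot hsin y).sub ((hasDerivAt_arctan_div hB₀ y).add
      (hasDerivAt_tsum hu hderiv hbound hg₀ y))).congr_deriv ?_
    rw [(hasSum_re_cot hB y).tsum_eq, re_cot_add_mul_I]
    ring
  have hconst := is_const_of_deriv_eq_zero (fun y => (hzero y).differentiableAt)
    (fun y => (hzero y).deriv) A 0
  have hA : arctan (tanh A * cot B) = arctan (A / B) + ∑' k, g k A := by
    simpa [hg, sub_eq_zero] using hconst
  rw [hA]
  exact hsum.hasSum.tendsto_sum_nat.const_add _
end

section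
/- For all real x and y with −π/2 < x < π/2 and −π/2 < y < π/2, the series ∑_{k=1}^{∞} [ ln( ((k − 1/2)π − y)/((k − 1/2)π − x) ) + ln( ((k − 1/2)π + y)/((k − 1/2)π + x) ) ] converges and its sum equals ln( cos y / cos x ). -/
open Filter Real Topology

/-- Splitting the first `2 * n` factors of Euler's sine product at `2 * t` by parity. -/
lemma prod_range_two_mul_euler_sin (t : ℝ) (n : ℕ) :
    ∏ j ∈ Finset.range (2 * n), (1 - (2 * t) ^ 2 / ((j : ℝ) + 1) ^ 2) =
      (∏ j ∈ Finset.range n, (1 - t ^ 2 / ((j : ℝ) + 1) ^ 2)) *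
        ∏ k ∈ Finset.range n, (1 - t ^ 2 / ((k : ℝ) + 1 - 1 / 2) ^ 2) := by
  induction n with
  | zero => simp
  | succ n ih =>
    rw [show 2 * (n + 1) = 2 * n + 1 + 1 by ring, Finset.prod_range_succ, Finset.prod_range_succ,
      ih, Finset.prod_range_succ, Finset.prod_range_succ]
    have hodd : (1 : ℝ) - (2 * t) ^ 2 / (((2 * n : ℕ) : ℝ) + 1) ^ 2 =
        1 - t ^ 2 / ((n : ℝ) + 1 - 1 / 2) ^ 2 := by
      have h : ((2 * n : ℕ) : ℝ) + 1 = 2 * ((n : ℝ) + 1 - 1 / 2) := by push_cast; ring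
      rw [h, mul_pow, mul_pow, mul_div_mul_left _ _ (by norm_num)]
    have heven : (1 : ℝ) - (2 * t) ^ 2 / (((2 * n + 1 : ℕ) : ℝ) + 1) ^ 2 =
        1 - t ^ 2 / ((n : ℝ) + 1) ^ 2 := by
      have h : ((2 * n + 1 : ℕ) : ℝ) + 1 = 2 * ((n : ℝ) + 1) := by push_cast; ring
      rw [h, mul_pow, mul_pow, mul_div_mul_left _ _ (by norm_num)]
    rw [hodd, heven]
    ring

/-- Euler's infinite product for the cosine, on `(-π, π)`. -/
lemma tendsto_euler_cos_prod {x : ℝ} (hx : x ∈ Set.Ioo (-π) π) :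
    Tendsto (fun n : ℕ => ∏ k ∈ Finset.range n, (1 - (x / π) ^ 2 / ((k : ℝ) + 1 - 1 / 2) ^ 2))
      atTop (𝓝 (Real.cos x)) := by
  rcases eq_or_ne x 0 with rfl | h0
  · simp
  have hsin : Real.sin x ≠ 0 := by
    rwa [Ne, Real.sin_eq_zero_iff_of_lt_of_lt hx.1 hx.2]
  have hπ : π * (x / π) = x := mul_div_cancel₀ x Real.pi_ne_zero
  have hS := Real.tendsto_euler_sin_prod (x / π)
  have hS₂ := (Real.tendsto_euler_sin_prod (2 * (x / π))).comp
    (tendsto_id.const_mul_atTop' (two_pos : 0 < 2))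
  rw [mul_left_comm, hπ, Real.sin_two_mul] at hS₂
  rw [hπ] at hS
  have hlim := hS₂.div (hS.const_mul 2) (mul_ne_zero two_ne_zero hsin)
  rw [mul_div_cancel_left₀ _ (mul_ne_zero two_ne_zero hsin)] at hlim
  refine hlim.congr' ?_
  filter_upwards [hS.eventually_ne hsin] with n hn
  simp only [Pi.div_apply, Function.comp_apply, id_eq]
  rw [prod_range_two_mul_euler_sin, div_eq_iff (mul_ne_zero two_ne_zero hn)]
  ring

/-- The factors of the cosine product are positive on `(-π/2, π/2)`. -/
lemma euler_cos_factor_pos {x : ℝ} (hx : x ∈ Set.Ioo (-(π / 2)) (π / 2)) (k : ℕ) :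
    0 < 1 - (x / π) ^ 2 / ((k : ℝ) + 1 - 1 / 2) ^ 2 := by
  have hk : (0 : ℝ) ≤ k := k.cast_nonneg
  have hlt : |x / π| < 1 / 2 := by
    rw [abs_div, abs_of_pos Real.pi_pos, div_lt_iff₀ Real.pi_pos]
    linarith [abs_lt.2 hx]
  rw [sub_pos, div_lt_one (by nlinarith), sq_lt_sq,
    abs_of_pos (by linarith : 0 < (k : ℝ) + 1 - 1 / 2)]
  linarith

/-- A term of the series is a difference of logarithms of factors of the cosine product. -/
lemma scherk_log_term {x y : ℝ} (hx : x ∈ Set.Ioo (-(π / 2)) (π / 2))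
    (hy : y ∈ Set.Ioo (-(π / 2)) (π / 2)) (k : ℕ) :
    Real.log (((((k : ℝ) + 1) - 1/2) * π - y) / ((((k : ℝ) + 1) - 1/2) * π - x)) +
        Real.log (((((k : ℝ) + 1) - 1/2) * π + y) / ((((k : ℝ) + 1) - 1/2) * π + x)) =
      Real.log (1 - (y / π) ^ 2 / ((k : ℝ) + 1 - 1 / 2) ^ 2) -
        Real.log (1 - (x / π) ^ 2 / ((k : ℝ) + 1 - 1 / 2) ^ 2) := by
  have hc : 0 < (k : ℝ) + 1 - 1 / 2 := by linarith [(k.cast_nonneg : (0 : ℝ) ≤ k)]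
  have hcπ : π / 2 ≤ ((k : ℝ) + 1 - 1 / 2) * π := by
    nlinarith [Real.pi_pos, mul_nonneg (k.cast_nonneg : (0 : ℝ) ≤ k) Real.pi_pos.le]
  have hfactor (z : ℝ) : 1 - (z / π) ^ 2 / ((k : ℝ) + 1 - 1 / 2) ^ 2 =
      (((k : ℝ) + 1 - 1 / 2) * π - z) * (((k : ℝ) + 1 - 1 / 2) * π + z) /
        (((k : ℝ) + 1 - 1 / 2) * π) ^ 2 := by
    generalize (k : ℝ) + 1 - 1 / 2 = c at hc
    field_simp
    ring
  obtain ⟨hx₁, hx₂⟩ := hx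
  obtain ⟨hy₁, hy₂⟩ := hy
  rw [hfactor, hfactor]
  generalize ((k : ℝ) + 1 - 1 / 2) * π = c at hcπ
  have hc₀ : c ≠ 0 := by linarith [Real.pi_pos]
  have hxm : c - x ≠ 0 := by linarith
  have hxp : c + x ≠ 0 := by linarith
  have hym : c - y ≠ 0 := by linarith
  have hyp : c + y ≠ 0 := by linarith
  rw [Real.log_div hym hxm, Real.log_div hyp hxp,
    Real.log_div (mul_ne_zero hym hyp) (pow_ne_zero 2 hc₀), Real.log_mul hym hyp,
    Real.log_div (mul_ne_zero hxm hxp) (pow_ne_zero 2 hc₀), Real.log_mul hxm hxp]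
  ring

/-- The logarithmic form of the cosine product on `(-π/2, π/2)`. -/
lemma tendsto_sum_log_euler_cos {x : ℝ} (hx : x ∈ Set.Ioo (-(π / 2)) (π / 2)) :
    Tendsto (fun n : ℕ => ∑ k ∈ Finset.range n,
        Real.log (1 - (x / π) ^ 2 / ((k : ℝ) + 1 - 1 / 2) ^ 2))
      atTop (𝓝 (Real.log (Real.cos x))) := by
  have hx' : x ∈ Set.Ioo (-π) π :=
    ⟨by linarith [hx.1, Real.pi_pos], by linarith [hx.2, Real.pi_pos]⟩
  refine ((tendsto_euler_cos_prod hx').log (Real.cos_pos_of_mem_Ioo hx).ne').congr fun n => ?_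
  exact Real.log_prod fun k _ => (euler_cos_factor_pos hx k).ne'

/-- Logarithmic form of Ramanujan's cosine product identity (Scherk's second
surface): for `x, y ∈ (-π/2, π/2)`, the series with `k`-th term
`ln(((k - 1/2)π - y)/((k - 1/2)π - x)) + ln(((k - 1/2)π + y)/((k - 1/2)π + x))`
converges to `ln (cos y / cos x)`. -/
theorem scherk_log_series (x y : ℝ)
    (hx : x ∈ Set.Ioo (-(π / 2)) (π / 2))
    (hy : y ∈ Set.Ioo (-(π / 2)) (π / 2)) :
    Tendsto
      (fun N : ℕ => ∑ k ∈ Finset.range N,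
        (Real.log (((((k : ℝ) + 1) - 1/2) * π - y) / ((((k : ℝ) + 1) - 1/2) * π - x)) +
          Real.log (((((k : ℝ) + 1) - 1/2) * π + y) / ((((k : ℝ) + 1) - 1/2) * π + x))))
      atTop (𝓝 (Real.log (Real.cos y / Real.cos x))) := by
  rw [Real.log_div (Real.cos_pos_of_mem_Ioo hy).ne' (Real.cos_pos_of_mem_Ioo hx).ne']
  simp only [scherk_log_term hx hy, Finset.sum_sub_distrib]
  exact (tendsto_sum_log_euler_cos hy).sub (tendsto_sum_log_euler_cos hx)
end

section
/- Let f : ℂ × ℂ → ℂ be twice continuously complex-differentiable and satisfy (1 + f_t²)·f_xx − 2·f_x·f_t·f_xt + (1 + f_x²)·f_tt = 0 at every point, where subscripts denote partial complex derivatives in the first (x) and second (t) coordinates. Define g : ℂ × ℂ → ℂ by g(x, t) := f(x, i·t). Then g satisfies (1 − g_t²)·g_xx + 2·g_x·g_t·g_xt − (1 + g_x²)·g_tt = 0 at every point. -/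
open Complex

/-- Partial complex derivative in the first coordinate of `f : ℂ × ℂ → ℂ`. -/
noncomputable def pdx (f : ℂ × ℂ → ℂ) (p : ℂ × ℂ) : ℂ :=
  deriv (fun x => f (x, p.2)) p.1

/-- Partial complex derivative in the second coordinate of `f : ℂ × ℂ → ℂ`. -/
noncomputable def pdt (f : ℂ × ℂ → ℂ) (p : ℂ × ℂ) : ℂ :=
  deriv (fun t => f (p.1, t)) p.2

/-- The Wick rotation `(x, t) ↦ (x, i t)` of the complex plane `ℂ × ℂ`. -/
noncomputable def wickMap (p : ℂ × ℂ) : ℂ × ℂ := (p.1, I * p.2)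

theorem pdx_comp_wickMap (f : ℂ × ℂ → ℂ) : pdx (f ∘ wickMap) = pdx f ∘ wickMap := rfl

theorem pdt_comp_wickMap (f : ℂ × ℂ → ℂ) :
    pdt (f ∘ wickMap) = fun p => I * (pdt f ∘ wickMap) p := by
  funext p
  exact deriv_comp_mul_left I (fun t => f (p.1, t)) p.2

theorem pdt_const_mul (c : ℂ) (f : ℂ × ℂ → ℂ) (p : ℂ × ℂ) :
    pdt (fun q => c * f q) p = c * pdt f p :=
  deriv_const_mul_field c

/-- Wick rotation `t → i t` carries the complexified minimal surface equation
to the Born–Infeld equation: if `f : ℂ × ℂ → ℂ` is twice continuously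
ℂ-differentiable and satisfies
`(1 + f_t²) f_xx - 2 f_x f_t f_xt + (1 + f_x²) f_tt = 0` everywhere, then
`g (x, t) := f (x, i t)` satisfies
`(1 - g_t²) g_xx + 2 g_x g_t g_xt - (1 + g_x²) g_tt = 0` everywhere. -/
theorem wick_rotation (f : ℂ × ℂ → ℂ) (hf : ContDiff ℂ 2 f)
    (hmin : ∀ p : ℂ × ℂ,
      (1 + (pdt f p) ^ 2) * pdx (pdx f) p -
        2 * pdx f p * pdt f p * pdt (pdx f) p +
        (1 + (pdx f p) ^ 2) * pdt (pdt f) p = 0)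
    (g : ℂ × ℂ → ℂ) (hg : ∀ p : ℂ × ℂ, g p = f (p.1, Complex.I * p.2)) :
    ∀ p : ℂ × ℂ,
      (1 - (pdt g p) ^ 2) * pdx (pdx g) p +
        2 * pdx g p * pdt g p * pdt (pdx g) p -
        (1 + (pdx g p) ^ 2) * pdt (pdt g) p = 0 := by
  intro p
  obtain rfl : g = f ∘ wickMap := funext hg
  have h := hmin (wickMap p)
  simp only [pdx_comp_wickMap, pdt_comp_wickMap, pdt_const_mul]
  simp only [Function.comp_apply]
  linear_combination h + (-(pdt f (wickMap p)) ^ 2 * pdx (pdx f) (wickMap p) +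
    2 * pdx f (wickMap p) * pdt f (wickMap p) * pdt (pdx f) (wickMap p) -
    (1 + pdx f (wickMap p) ^ 2) * pdt (pdt f) (wickMap p)) * I_sq
end
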